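/- arXiv:1911.03816 — 2 statements merged into one kernel-verified Lean document; each statement's English description precedes it below -/
import Mathlib

section
/- Let √2 − 1 < α < 1. Then any ℕ-valued random variable X satisfying the recursive distributional equation has 1 − α < P(X = 0) ≤ 2/((3 + 2√2)α + 1), and E[X] = ∞ (i.e. ∑_{k≥0} k·P(X = k) = ∞). -/
open scoped ENNReal

/-- The Poisson(α) probability mass function on ℕ. -/
noncomputable def poissonPMF (α : ℝ) (k : ℕ) : ℝ≥0∞ :=
  ENNReal.ofReal (Real.exp (-α) * α ^ k / (Nat.factorial k))

/-- The Geometric(1/2) pmf: P(N = k) = (1/2)^(k+1) for k ≥ 0. -/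
noncomputable def geomHalf (k : ℕ) : ℝ≥0∞ := (1 / 2) ^ (k + 1)

/-- The law of (X - 1)⁺ when X has law μ on ℕ. -/
noncomputable def shiftLaw (μ : ℕ → ℝ≥0∞) (k : ℕ) : ℝ≥0∞ :=
  if k = 0 then μ 0 + μ 1 else μ (k + 1)

/-- Convolution of two (sub-)pmfs on ℕ: the law of an independent sum. -/
noncomputable def convAdd (f g : ℕ → ℝ≥0∞) (k : ℕ) : ℝ≥0∞ :=
  ∑ j ∈ Finset.range (k + 1), f j * g (k - j)

/-- n-fold convolution of a pmf on ℕ: the law of a sum of n i.i.d. copies. -/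
noncomputable def iterConv (f : ℕ → ℝ≥0∞) : ℕ → ℕ → ℝ≥0∞
  | 0 => fun k => if k = 0 then 1 else 0
  | n + 1 => convAdd (iterConv f n) f

/-- μ is the law of an ℕ-valued random variable X satisfying the RDE
    X =_d P + ∑_{i=1}^N (X_i - 1)⁺, with P ~ Poisson(α), N ~ Geom(1/2),
    X_i i.i.d. with law μ, all independent. -/
def SatisfiesRDE (α : ℝ) (μ : ℕ → ℝ≥0∞) : Prop :=
  (∑' k, μ k) = 1 ∧
  ∀ k, μ k = ∑' n, geomHalf n * convAdd (poissonPMF α) (iterConv (shiftLaw μ) n) k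

/-- The probability generating function G(s) = E[s^X]. -/
noncomputable def pgf (μ : ℕ → ℝ≥0∞) (s : ℝ) : ℝ := ∑' k, (μ k).toReal * s ^ k

/-- The mean E[X] = ∑ k · P(X = k), valued in [0,∞]. -/
noncomputable def meanENN (μ : ℕ → ℝ≥0∞) : ℝ≥0∞ := ∑' k : ℕ, (k : ℝ≥0∞) * μ k

/-- The generating function `∑ f k * s ^ k`, with values in `[0, ∞]`. -/
noncomputable def genFun (f : ℕ → ℝ≥0∞) (s : ℝ≥0∞) : ℝ≥0∞ := ∑' k, f k * s ^ k

lemma genFun_convAdd (f g : ℕ → ℝ≥0∞) (s : ℝ≥0∞) :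
    genFun (convAdd f g) s = genFun f s * genFun g s := by
  have h : genFun f s * genFun g s =
      ∑' x : ℕ × ℕ, (f x.1 * s ^ x.1) * (g x.2 * s ^ x.2) := by
    rw [ENNReal.tsum_prod', genFun, ← ENNReal.tsum_mul_right]
    exact tsum_congr fun i => ENNReal.tsum_mul_left.symm
  rw [h, ← Finset.HasAntidiagonal.sigmaAntidiagonalEquivProd.tsum_eq, ENNReal.tsum_sigma', genFun]
  refine tsum_congr fun n => ?_
  rw [tsum_fintype]
  change _ = ∑ x : Finset.HasAntidiagonal.antidiagonal n,
    (f x.1.1 * s ^ x.1.1) * (g x.1.2 * s ^ x.1.2)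
  rw [Finset.sum_coe_sort (Finset.HasAntidiagonal.antidiagonal n)
    (fun x : ℕ × ℕ => (f x.1 * s ^ x.1) * (g x.2 * s ^ x.2)),
    Finset.Nat.sum_antidiagonal_eq_sum_range_succ
      (fun i j => (f i * s ^ i) * (g j * s ^ j)), convAdd, Finset.sum_mul]
  refine Finset.sum_congr rfl fun j hj => ?_
  have hjn : j + (n - j) = n := by
    have := Finset.mem_range.mp hj
    omega
  calc f j * g (n - j) * s ^ n = f j * g (n - j) * s ^ (j + (n - j)) := by rw [hjn]
    _ = _ := by rw [pow_add]; ring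

lemma genFun_iterConv (f : ℕ → ℝ≥0∞) (s : ℝ≥0∞) (n : ℕ) :
    genFun (iterConv f n) s = genFun f s ^ n := by
  induction n with
  | zero =>
    rw [genFun, tsum_eq_single 0]
    · simp [iterConv]
    · intro k hk
      simp [iterConv, hk]
  | succ n ih => rw [iterConv, genFun_convAdd, ih, pow_succ]

lemma genFun_poissonPMF {α s : ℝ} (hα : 0 ≤ α) (hs : 0 ≤ s) :
    genFun (poissonPMF α) (ENNReal.ofReal s) = ENNReal.ofReal (Real.exp (α * (s - 1))) := by
  have h : HasSum (fun k : ℕ => Real.exp (-α) * α ^ k / (Nat.factorial k) * s ^ k)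
      (Real.exp (α * (s - 1))) := by
    have h1 : HasSum (fun k : ℕ => Real.exp (-α) * ((α * s) ^ k / (Nat.factorial k)))
        (Real.exp (-α) * Real.exp (α * s)) := by
      rw [Real.exp_eq_exp_ℝ]
      exact (NormedSpace.expSeries_div_hasSum_exp (α * s)).mul_left _
    have he : α * (s - 1) = -α + α * s := by ring
    rw [he, Real.exp_add]
    convert h1 using 2 with k
    rw [mul_pow]
    ring
  rw [← h.tsum_eq, ENNReal.ofReal_tsum_of_nonneg (fun k => by positivity) h.summable, genFun]
  refine tsum_congr fun k => ?_
  rw [poissonPMF, ← ENNReal.ofReal_pow hs, ← ENNReal.ofReal_mul (by positivity)]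

lemma genFun_zero (f : ℕ → ℝ≥0∞) : genFun f 0 = f 0 := by
  rw [genFun, tsum_eq_single 0]
  · simp
  · intro k hk
    simp [hk]

lemma genFun_le_one {f : ℕ → ℝ≥0∞} (hf : ∑' k, f k = 1) {s : ℝ≥0∞} (hs : s ≤ 1) :
    genFun f s ≤ 1 := by
  rw [← hf]
  exact ENNReal.tsum_le_tsum fun k => mul_le_of_le_one_right' (pow_le_one' hs k)

lemma tsum_shiftLaw (μ : ℕ → ℝ≥0∞) : ∑' k, shiftLaw μ k = ∑' k, μ k := by
  rw [tsum_eq_zero_add' ENNReal.summable, tsum_eq_zero_add' (f := μ) ENNReal.summable,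
    tsum_eq_zero_add' (f := fun k => μ (k + 1)) ENNReal.summable]
  simp [shiftLaw, add_assoc]

lemma genFun_shiftLaw (μ : ℕ → ℝ≥0∞) (s : ℝ≥0∞) :
    s * genFun (shiftLaw μ) s + μ 0 = s * μ 0 + genFun μ s := by
  have h1 : genFun (shiftLaw μ) s = μ 0 + ∑' k, μ (k + 1) * s ^ k := by
    rw [genFun, tsum_eq_zero_add' ENNReal.summable,
      tsum_eq_zero_add' (f := fun k => μ (k + 1) * s ^ k) ENNReal.summable]
    simp [shiftLaw, add_assoc]
  have h2 : genFun μ s = μ 0 + s * ∑' k, μ (k + 1) * s ^ k := by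
    rw [genFun, tsum_eq_zero_add' ENNReal.summable, ← ENNReal.tsum_mul_left]
    congr 1
    · simp
    · exact tsum_congr fun k => by rw [pow_succ]; ring
  rw [h1, h2]
  ring

lemma SatisfiesRDE.genFun_eq {α : ℝ} {μ : ℕ → ℝ≥0∞} (hμ : SatisfiesRDE α μ) (s : ℝ≥0∞) :
    genFun μ s =
      genFun (poissonPMF α) s * (2⁻¹ * (1 - 2⁻¹ * genFun (shiftLaw μ) s)⁻¹) := by
  have h1 : genFun μ s = ∑' n, geomHalf n *
      genFun (convAdd (poissonPMF α) (iterConv (shiftLaw μ) n)) s := by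
    simp only [genFun, ← ENNReal.tsum_mul_left]
    rw [ENNReal.tsum_comm]
    refine tsum_congr fun k => ?_
    rw [hμ.2 k, ← ENNReal.tsum_mul_right]
    exact tsum_congr fun n => by ring
  rw [h1, ← ENNReal.tsum_geometric, ← ENNReal.tsum_mul_left, ← ENNReal.tsum_mul_left]
  refine tsum_congr fun n => ?_
  rw [genFun_convAdd, genFun_iterConv, geomHalf, mul_pow, one_div, pow_succ]
  ring

lemma SatisfiesRDE.two_sub_genFun_mul {α : ℝ} (hα : 0 ≤ α) {μ : ℕ → ℝ≥0∞}
    (hμ : SatisfiesRDE α μ) {s : ℝ} (hs0 : 0 ≤ s) (hs1 : s ≤ 1) :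
    (genFun μ (ENNReal.ofReal s)).toReal *
      (2 - (genFun (shiftLaw μ) (ENNReal.ofReal s)).toReal) = Real.exp (α * (s - 1)) := by
  have hH : genFun (shiftLaw μ) (ENNReal.ofReal s) ≤ 1 :=
    genFun_le_one ((tsum_shiftLaw μ).trans hμ.1) (ENNReal.ofReal_le_one.mpr hs1)
  have h := congrArg ENNReal.toReal (hμ.genFun_eq (ENNReal.ofReal s))
  have hle : 2⁻¹ * genFun (shiftLaw μ) (ENNReal.ofReal s) ≤ 1 :=
    mul_le_one' (by simp) hH
  have hHr : (genFun (shiftLaw μ) (ENNReal.ofReal s)).toReal ≤ 1 :=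
    ENNReal.toReal_le_of_le_ofReal zero_le_one (by simpa using hH)
  rw [genFun_poissonPMF hα hs0, ENNReal.toReal_mul, ENNReal.toReal_mul, ENNReal.toReal_inv,
    ENNReal.toReal_inv, ENNReal.toReal_sub_of_le hle ENNReal.one_ne_top, ENNReal.toReal_mul,
    ENNReal.toReal_inv, ENNReal.toReal_ofReal (Real.exp_pos _).le] at h
  simp only [ENNReal.toReal_ofNat, ENNReal.toReal_one] at h
  rw [h]
  have : (1 : ℝ) - 2⁻¹ * (genFun (shiftLaw μ) (ENNReal.ofReal s)).toReal ≠ 0 := by linarith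
  have : (2 : ℝ) - (genFun (shiftLaw μ) (ENNReal.ofReal s)).toReal ≠ 0 := by linarith
  field_simp

/-- The quadratic equation for the generating function, with the square completed. -/
lemma SatisfiesRDE.sq_two_mul_genFun_sub {α : ℝ} (hα : 0 ≤ α) {μ : ℕ → ℝ≥0∞}
    (hμ : SatisfiesRDE α μ) {s : ℝ} (hs0 : 0 ≤ s) (hs1 : s ≤ 1) :
    (2 * (genFun μ (ENNReal.ofReal s)).toReal - ((2 - (μ 0).toReal) * s + (μ 0).toReal)) ^ 2 =
      ((2 - (μ 0).toReal) * s + (μ 0).toReal) ^ 2 - 4 * s * Real.exp (α * (s - 1)) := by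
  have hs : ENNReal.ofReal s ≤ 1 := ENNReal.ofReal_le_one.mpr hs1
  have hG := ne_top_of_le_ne_top ENNReal.one_ne_top (genFun_le_one hμ.1 hs)
  have hH := ne_top_of_le_ne_top ENNReal.one_ne_top
    (genFun_le_one ((tsum_shiftLaw μ).trans hμ.1) hs)
  have h0 : μ 0 ≠ ⊤ := ENNReal.ne_top_of_tsum_ne_top (hμ.1.trans_ne ENNReal.one_ne_top) 0
  have h := congrArg ENNReal.toReal (genFun_shiftLaw μ (ENNReal.ofReal s))
  rw [ENNReal.toReal_add (ENNReal.mul_ne_top ENNReal.ofReal_ne_top hH) h0,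
    ENNReal.toReal_add (ENNReal.mul_ne_top ENNReal.ofReal_ne_top h0) hG,
    ENNReal.toReal_mul, ENNReal.toReal_mul, ENNReal.toReal_ofReal hs0] at h
  rw [← hμ.two_sub_genFun_mul hα hs0 hs1]
  linear_combination (-4 * (genFun μ (ENNReal.ofReal s)).toReal) * h

lemma continuousOn_toReal_genFun {μ : ℕ → ℝ≥0∞} (hμ : ∑' k, μ k = 1) :
    ContinuousOn (fun s : ℝ => (genFun μ (ENNReal.ofReal s)).toReal) (Set.Icc 0 1) := by
  have hne : ∑' k, μ k ≠ ⊤ := hμ.trans_ne ENNReal.one_ne_top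
  have h : ContinuousOn (fun s : ℝ => ∑' k, (μ k).toReal * s ^ k) (Set.Icc 0 1) := by
    refine continuousOn_tsum (fun k => by fun_prop) (ENNReal.summable_toReal hne) ?_
    intro k s hs
    rw [Real.norm_of_nonneg (mul_nonneg ENNReal.toReal_nonneg (pow_nonneg hs.1 k))]
    exact mul_le_of_le_one_right ENNReal.toReal_nonneg (pow_le_one₀ hs.1 hs.2)
  refine h.congr fun s hs => ?_
  simp only [genFun]
  rw [ENNReal.tsum_toReal_eq fun k => ENNReal.mul_ne_top
    (ENNReal.ne_top_of_tsum_ne_top hne k) (ENNReal.pow_ne_top ENNReal.ofReal_ne_top)]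
  refine tsum_congr fun k => ?_
  rw [ENNReal.toReal_mul, ENNReal.toReal_pow, ENNReal.toReal_ofReal hs.1]

lemma one_sub_toReal_genFun_le {μ : ℕ → ℝ≥0∞} (hμ : ∑' k, μ k = 1) (hm : meanENN μ ≠ ⊤)
    {s : ℝ} (hs0 : 0 ≤ s) (hs1 : s ≤ 1) :
    1 - (genFun μ (ENNReal.ofReal s)).toReal ≤ (meanENN μ).toReal * (1 - s) := by
  have hG := ne_top_of_le_ne_top ENNReal.one_ne_top
    (genFun_le_one hμ (ENNReal.ofReal_le_one.mpr hs1))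
  have h : (1 : ℝ≥0∞) ≤
      genFun μ (ENNReal.ofReal s) + meanENN μ * ENNReal.ofReal (1 - s) := by
    rw [← hμ, genFun, meanENN, ← ENNReal.tsum_mul_right, ← ENNReal.tsum_add]
    refine ENNReal.tsum_le_tsum fun k => ?_
    have hk : (1 : ℝ≥0∞) ≤ ENNReal.ofReal s ^ k + k * ENNReal.ofReal (1 - s) := by
      have hb := one_add_mul_le_pow (a := s - 1) (by linarith) k
      rw [← ENNReal.ofReal_pow hs0, ← ENNReal.ofReal_natCast k,
        ← ENNReal.ofReal_mul (Nat.cast_nonneg k),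
        ← ENNReal.ofReal_add (pow_nonneg hs0 k)
          (mul_nonneg (Nat.cast_nonneg k) (sub_nonneg.mpr hs1)), ← ENNReal.ofReal_one]
      apply ENNReal.ofReal_le_ofReal
      have he : 1 + (s - 1) = s := by ring
      rw [he] at hb
      linarith
    calc μ k = μ k * 1 := (mul_one _).symm
      _ ≤ μ k * (ENNReal.ofReal s ^ k + k * ENNReal.ofReal (1 - s)) := by gcongr
      _ = _ := by ring
  have hM := ENNReal.mul_ne_top hm (ENNReal.ofReal_ne_top (r := 1 - s))
  have h' := ENNReal.toReal_mono (ENNReal.add_ne_top.mpr ⟨hG, hM⟩) h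
  rw [ENNReal.toReal_one, ENNReal.toReal_add hG hM, ENNReal.toReal_mul,
    ENNReal.toReal_ofReal (sub_nonneg.mpr hs1)] at h'
  linarith

/-- If the discriminant is nonnegative on `[0, 1]` and `√2 - 1 < α`, then `1 - α < p`. -/
lemma one_sub_lt_of_discrim_nonneg {α p : ℝ} (hα0 : √2 - 1 < α) (hα1 : α < 1) (hp : 0 ≤ p)
    (hD : ∀ s ∈ Set.Icc (0 : ℝ) 1,
      0 ≤ ((2 - p) * s + p) ^ 2 - 4 * s * Real.exp (α * (s - 1))) :
    1 - α < p := by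
  by_contra! hle
  have hα : 0 < α := by
    have := Real.one_le_sqrt.mpr (one_le_two (α := ℝ))
    linarith
  set d := α ^ 2 + 2 * α - 1 with hd
  have hdpos : 0 < d := by
    nlinarith [Real.sq_sqrt (zero_le_two (α := ℝ)), Real.sqrt_nonneg 2]
  have hd2 : d < 2 := by nlinarith
  obtain ⟨x, hx⟩ : ∃ x, x = d / 8 := ⟨_, rfl⟩
  have hx0 : 0 < x := by linarith
  have hx1 : x < 1 / 4 := by linarith
  have hs := hD (1 - x) ⟨by linarith, by linarith⟩
  have hL : ((2 - p) * (1 - x) + p) ^ 2 ≤ (2 - (1 + α) * x) ^ 2 := by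
    apply pow_le_pow_left₀
    · nlinarith
    · nlinarith
  have hax : 0 < α * x := by positivity
  have hax1 : α * x ≤ 1 := by nlinarith
  have he := Real.exp_bound (x := -(α * x)) (n := 3)
    (by rw [abs_neg, abs_of_pos hax]; exact hax1) (by norm_num)
  rw [abs_neg, abs_of_pos hax] at he
  have he' := (abs_le.mp he).1
  norm_num [Finset.sum_range_succ, Nat.factorial] at he'
  have harg : α * (1 - x - 1) = -(α * x) := by ring
  rw [harg] at hs
  have hE : (1 - x) * (1 - α * x + (α * x) ^ 2 / 2 - (α * x) ^ 3 * (2 / 9)) ≤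
      (1 - x) * Real.exp (-(α * x)) := by
    apply mul_le_mul_of_nonneg_left _ (by linarith)
    linarith
  have hkey : 0 ≤ x ^ 2 * (-d + x * (2 * α ^ 2 + 8 / 9 * α ^ 3 * (1 - x))) := by
    nlinarith
  have hneg : -d + x * (2 * α ^ 2 + 8 / 9 * α ^ 3 * (1 - x)) < 0 := by
    have h2 : α ^ 2 ≤ 1 := pow_le_one₀ hα.le hα1.le
    have h3 : α ^ 3 ≤ 1 := pow_le_one₀ hα.le hα1.le
    have h4 : α ^ 3 * (1 - x) ≤ 1 := mul_le_one₀ h3 (by linarith) (by linarith)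
    nlinarith
  nlinarith [sq_pos_of_pos hx0]

lemma discrim_lower_bound {α : ℝ} (hα : 0 ≤ α) (p : ℝ) {x : ℝ} (hx : 0 ≤ x) :
    4 * (p + α - 1) * x - 4 * (1 + α) ^ 2 * x ^ 2 ≤
      ((2 - p) * (1 - x) + p) ^ 2 - 4 * (1 - x) * Real.exp (α * (1 - x - 1)) := by
  have hy : 0 ≤ (1 + α) * x := by positivity
  have h1 : (1 - x) * Real.exp (α * (1 - x - 1)) ≤ Real.exp (-((1 + α) * x)) := by
    have := Real.add_one_le_exp (-x)
    have he : Real.exp (-((1 + α) * x)) = Real.exp (-x) * Real.exp (α * (1 - x - 1)) := by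
      rw [← Real.exp_add]
      ring_nf
    rw [he]
    exact mul_le_mul_of_nonneg_right (by linarith) (Real.exp_pos _).le
  have h2 : Real.exp (-((1 + α) * x)) ≤ 1 - (1 + α) * x + ((1 + α) * x) ^ 2 := by
    set y := (1 + α) * x
    have h3 := Real.add_one_le_exp y
    have h4 : Real.exp (-y) * Real.exp y = 1 := by rw [← Real.exp_add]; simp
    have h5 := Real.exp_pos (-y)
    have h6 : Real.exp (-y) * (1 + y) ≤ 1 := by nlinarith
    have h7 : (1 : ℝ) ≤ (1 - y + y ^ 2) * (1 + y) := by nlinarith [pow_nonneg hy 3]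
    nlinarith
  nlinarith [sq_nonneg ((2 - p) * x)]

/-- A linear function that is positive to first order dominates any quadratic near zero. -/
lemma exists_quadratic_lt_linear {c : ℝ} (hc : 0 < c) (C : ℝ) :
    ∃ x : ℝ, 0 < x ∧ x < 1 ∧ C * x ^ 2 < c * x := by
  have hpos : 0 < |C| + c + 1 := by positivity
  refine ⟨c / (|C| + c + 1), by positivity, ?_, ?_⟩
  · rw [div_lt_one hpos]
    linarith [abs_nonneg C]
  · have hx : 0 < c / (|C| + c + 1) := by positivity
    have hm : c / (|C| + c + 1) * (|C| + c + 1) = c := by field_simp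
    set x := c / (|C| + c + 1)
    have : C * x < c := by nlinarith [le_abs_self C]
    nlinarith

/-- If the discriminant is nonnegative on `[0, 1]` and vanishes inside, then its zero is double,
which bounds `p` from above. -/
lemma le_of_discrim_eq_zero {α p s : ℝ} (hα : 0 < α) (hp0 : 0 < p) (hp1 : p ≤ 1)
    (hD : ∀ s ∈ Set.Icc (0 : ℝ) 1,
      0 ≤ ((2 - p) * s + p) ^ 2 - 4 * s * Real.exp (α * (s - 1)))
    (hs : s ∈ Set.Ioo (0 : ℝ) 1)
    (hs0 : ((2 - p) * s + p) ^ 2 - 4 * s * Real.exp (α * (s - 1)) = 0) :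
    p ≤ 2 / ((3 + 2 * √2) * α + 1) := by
  have hmin : IsLocalMin
      (fun s : ℝ => ((2 - p) * s + p) ^ 2 - 4 * s * Real.exp (α * (s - 1))) s := by
    filter_upwards [Ioo_mem_nhds hs.1 hs.2] with t ht
    rw [hs0]
    exact hD t ⟨ht.1.le, ht.2.le⟩
  have hderiv : HasDerivAt
      (fun s : ℝ => ((2 - p) * s + p) ^ 2 - 4 * s * Real.exp (α * (s - 1)))
      (2 * ((2 - p) * s + p) * (2 - p) -
        (4 * Real.exp (α * (s - 1)) + 4 * s * (Real.exp (α * (s - 1)) * α))) s := by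
    have h1 : HasDerivAt (fun s : ℝ => (2 - p) * s + p) (2 - p) s := by
      simpa using ((hasDerivAt_id s).const_mul (2 - p)).add_const p
    have h2 : HasDerivAt (fun s : ℝ => α * (s - 1)) α s := by
      simpa using ((hasDerivAt_id s).sub_const 1).const_mul α
    have h3 : HasDerivAt (fun s : ℝ => 4 * s) 4 s := by
      simpa using (hasDerivAt_id s).const_mul 4
    exact ((h1.pow 2).sub (h3.mul h2.exp)).congr_deriv (by norm_num)
  have h0 := hmin.hasDerivAt_eq_zero hderiv
  set E := Real.exp (α * (s - 1))
  have hspos := hs.1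
  have hL : 0 < (2 - p) * s + p := by nlinarith
  have hq : α * (2 - p) * s ^ 2 + (α * p - (2 - p)) * s + p = 0 := by
    have h : ((2 - p) * s + p) *
        (α * (2 - p) * s ^ 2 + (α * p - (2 - p)) * s + p) = 0 := by
      linear_combination (-s) * h0 + (1 + α * s) * hs0
    exact (mul_eq_zero.mp h).resolve_left hL.ne'
  have hu : 0 < 2 - p := by linarith
  have ht : 0 < α * p := by positivity
  have hdis : 4 * (α * p) * (2 - p) ≤ ((2 - p) - α * p) ^ 2 := by
    nlinarith [sq_nonneg (2 * (α * (2 - p)) * s + (α * p - (2 - p)))]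
  have hpos : 0 < (2 - p) - α * p := by
    by_contra! hcon
    have : 0 < α * (2 - p) * s ^ 2 := by positivity
    nlinarith
  have hr := Real.sq_sqrt (zero_le_two (α := ℝ))
  have hr0 := Real.sqrt_nonneg 2
  have hfac : 0 ≤ ((2 - p) - (3 + 2 * √2) * (α * p)) * ((2 - p) - (3 - 2 * √2) * (α * p)) := by
    have h : ((2 - p) - (3 + 2 * √2) * (α * p)) * ((2 - p) - (3 - 2 * √2) * (α * p)) =
        ((2 - p) - α * p) ^ 2 - 4 * (α * p) * (2 - p) := by
      linear_combination (-4 * (α * p) ^ 2) * hr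
    rw [h]
    exact sub_nonneg.mpr hdis
  have hmain : (3 + 2 * √2) * (α * p) ≤ 2 - p := by
    by_contra! hcon
    have h3 : (2 - p) - (3 - 2 * √2) * (α * p) ≤ 0 := by
      by_contra! hcon2
      nlinarith
    have hr1 : 1 < √2 := Real.one_lt_sqrt_two
    nlinarith
  rw [le_div_iff₀ (by positivity)]
  linarith

/-- For √2 − 1 < α < 1, any X satisfying the RDE has
1 − α < P(X = 0) ≤ 2/((3 + 2√2)α + 1) and E[X] = ∞. -/
theorem large_alpha_prob_zero_bounds_and_infinite_mean
    (α : ℝ) (hα0 : Real.sqrt 2 - 1 < α) (hα1 : α < 1)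
    (μ : ℕ → ℝ≥0∞) (hμ : SatisfiesRDE α μ) :
    1 - α < (μ 0).toReal ∧
    (μ 0).toReal ≤ 2 / ((3 + 2 * Real.sqrt 2) * α + 1) ∧
    meanENN μ = ⊤ := by
  have hα : 0 < α := by
    have := Real.one_le_sqrt.mpr (one_le_two (α := ℝ))
    linarith
  set p := (μ 0).toReal with hp
  have hsq := fun s (hs : s ∈ Set.Icc (0 : ℝ) 1) => hμ.sq_two_mul_genFun_sub hα.le hs.1 hs.2
  rw [← hp] at hsq
  have hG1 : ∀ s ∈ Set.Icc (0 : ℝ) 1, (genFun μ (ENNReal.ofReal s)).toReal ≤ 1 := fun s hs =>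
    ENNReal.toReal_le_of_le_ofReal zero_le_one
      (by simpa using genFun_le_one hμ.1 (ENNReal.ofReal_le_one.mpr hs.2))
  have hG0 : (genFun μ (ENNReal.ofReal 0)).toReal = p := by
    rw [ENNReal.ofReal_zero, genFun_zero]
  have hcont := continuousOn_toReal_genFun hμ.1
  have hmean := fun hm s (hs : s ∈ Set.Icc (0 : ℝ) 1) =>
    one_sub_toReal_genFun_le hμ.1 hm hs.1 hs.2
  set G := fun s : ℝ => (genFun μ (ENNReal.ofReal s)).toReal with hG
  change ∀ s ∈ Set.Icc (0 : ℝ) 1, G s ≤ 1 at hG1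
  change G 0 = p at hG0
  change ∀ s ∈ Set.Icc (0 : ℝ) 1, (2 * G s - ((2 - p) * s + p)) ^ 2 = _ at hsq
  have hD : ∀ s ∈ Set.Icc (0 : ℝ) 1,
      0 ≤ ((2 - p) * s + p) ^ 2 - 4 * s * Real.exp (α * (s - 1)) := fun s hs => by
    rw [← hsq s hs]
    positivity
  have hp0 : 0 ≤ p := ENNReal.toReal_nonneg
  have hp1 : p ≤ 1 := hG0 ▸ hG1 0 (by simp)
  have hlt := one_sub_lt_of_discrim_nonneg hα0 hα1 hp0 hD
  refine ⟨hlt, ?_, ?_⟩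
  · obtain ⟨x, hx0, hx1, hx⟩ := exists_quadratic_lt_linear
      (c := 4 * (p + α - 1)) (by linarith) (4 * (1 + α) ^ 2 + 4)
    have hmem : 1 - x ∈ Set.Icc (0 : ℝ) 1 := ⟨by linarith, by linarith⟩
    have hlow := discrim_lower_bound hα.le p hx0.le
    rw [← hsq _ hmem] at hlow
    have hneg : 2 * G (1 - x) - ((2 - p) * (1 - x) + p) < 0 := by
      by_contra! hcon
      have hup : 2 * G (1 - x) - ((2 - p) * (1 - x) + p) ≤ 2 * x := by
        nlinarith [hG1 _ hmem]
      nlinarith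
    have hf : ContinuousOn (fun s => 2 * G s - ((2 - p) * s + p)) (Set.Icc 0 (1 - x)) :=
      ((hcont.mono (Set.Icc_subset_Icc_right hmem.2)).const_mul 2).sub (by fun_prop)
    have hppos : 0 < p := by linarith
    obtain ⟨s, hs, hs0⟩ := intermediate_value_Ioo' hmem.1 hf
      (show (0 : ℝ) ∈ Set.Ioo _ _ from ⟨hneg, by rw [hG0]; linarith⟩)
    have hs1 : s ∈ Set.Ioo (0 : ℝ) 1 := ⟨hs.1, by linarith [hs.2]⟩
    refine le_of_discrim_eq_zero hα hppos hp1 hD hs1 ?_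
    rw [← hsq s ⟨hs1.1.le, hs1.2.le⟩]
    simp only at hs0
    rw [hs0]
    norm_num
  · by_contra hm
    set M := (meanENN μ).toReal
    have hM : 0 ≤ M := ENNReal.toReal_nonneg
    obtain ⟨x, hx0, hx1, hx⟩ := exists_quadratic_lt_linear
      (c := 4 * (p + α - 1)) (by linarith) (4 * (1 + α) ^ 2 + (2 * M + 2) ^ 2)
    have hmem : 1 - x ∈ Set.Icc (0 : ℝ) 1 := ⟨by linarith, by linarith⟩
    have hlow := discrim_lower_bound hα.le p hx0.le
    rw [← hsq _ hmem] at hlow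
    have hGlow : 1 - G (1 - x) ≤ M * (1 - (1 - x)) := hmean hm _ hmem
    have hMx : 0 ≤ M * x := by positivity
    have habs : |2 * G (1 - x) - ((2 - p) * (1 - x) + p)| ≤ (2 * M + 2) * x := by
      rw [abs_le]
      constructor <;> nlinarith [hG1 _ hmem]
    have := sq_le_sq' (abs_le.mp habs).1 (abs_le.mp habs).2
    nlinarith
end

section
/- Let 0 < α ≤ √2 − 1, let X be an ℕ-valued random variable satisfying the recursive distributional equation, and let Y be an ℕ-valued random variable with Y =_d P + ∑_{i=1}^{N₁+N₂} (X_i − 1)⁺, where P is Poisson(α), N₁ and N₂ are Geometric(1/2), X₁, X₂, ... are i.i.d. copies of X, and all random variables on the right-hand side are independent. Then E[Y] = 1 − √(1 − 2α − α²) and P(Y = 0) = (1−α)²·exp(α). -/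
open scoped ENNReal

/-- The law of Y = P + ∑_{i=1}^{N₁+N₂} (X_i − 1)⁺, where P ~ Poisson(α), N₁, N₂ are
independent Geometric(1/2), and the X_i are i.i.d. with law μ, all independent. -/
noncomputable def lawY (α : ℝ) (μ : ℕ → ℝ≥0∞) (k : ℕ) : ℝ≥0∞ :=
  ∑' n, convAdd geomHalf geomHalf n * convAdd (poissonPMF α) (iterConv (shiftLaw μ) n) k

/-- The probability generating function of a weight on ℕ, valued in [0,∞]. -/
noncomputable def pgfENN (f : ℕ → ℝ≥0∞) (s : ℝ≥0∞) : ℝ≥0∞ := ∑' k, f k * s ^ k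

lemma pgfENN_mono (f : ℕ → ℝ≥0∞) : Monotone (pgfENN f) := fun _ _ h =>
  ENNReal.tsum_le_tsum fun k => by gcongr

lemma pgfENN_one (f : ℕ → ℝ≥0∞) : pgfENN f 1 = ∑' k, f k := by simp [pgfENN]

lemma pgfENN_zero (f : ℕ → ℝ≥0∞) : pgfENN f 0 = f 0 := by
  rw [pgfENN, tsum_eq_single 0 fun k hk => by simp [hk]]
  simp

lemma pgfENN_convAdd (f g : ℕ → ℝ≥0∞) (s : ℝ≥0∞) :
    pgfENN (convAdd f g) s = pgfENN f s * pgfENN g s := by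
  calc pgfENN (convAdd f g) s
      = ∑' n, ∑' x : Finset.HasAntidiagonal.antidiagonal n,
          (f x.1.1 * s ^ x.1.1) * (g x.1.2 * s ^ x.1.2) := by
        refine tsum_congr fun n => ?_
        rw [Finset.tsum_subtype (Finset.HasAntidiagonal.antidiagonal n)
          (fun x : ℕ × ℕ => (f x.1 * s ^ x.1) * (g x.2 * s ^ x.2)), convAdd,
          ← Finset.Nat.sum_antidiagonal_eq_sum_range_succ (fun i j => f i * g j), Finset.sum_mul]
        refine Finset.sum_congr rfl fun x hx => ?_
        rw [← Finset.HasAntidiagonal.mem_antidiagonal.1 hx, pow_add]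
        ring
    _ = ∑' x : ℕ × ℕ, (f x.1 * s ^ x.1) * (g x.2 * s ^ x.2) := by
        rw [← ENNReal.tsum_sigma' (fun x : Σ n : ℕ, Finset.HasAntidiagonal.antidiagonal n =>
          (f x.2.1.1 * s ^ x.2.1.1) * (g x.2.1.2 * s ^ x.2.1.2))]
        exact Finset.HasAntidiagonal.sigmaAntidiagonalEquivProd.tsum_eq
          (fun x : ℕ × ℕ => (f x.1 * s ^ x.1) * (g x.2 * s ^ x.2))
    _ = pgfENN f s * pgfENN g s := by
        rw [ENNReal.tsum_prod', pgfENN, pgfENN, ← ENNReal.tsum_mul_right]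
        simp only [ENNReal.tsum_mul_left]

lemma pgfENN_iterConv (f : ℕ → ℝ≥0∞) (s : ℝ≥0∞) (n : ℕ) :
    pgfENN (iterConv f n) s = pgfENN f s ^ n := by
  induction n with
  | zero =>
    rw [pgfENN, tsum_eq_single 0 fun k hk => by simp [iterConv, hk]]
    simp [iterConv]
  | succ n ih => rw [iterConv, pgfENN_convAdd, ih, pow_succ]

lemma pgfENN_randomSum (c p f : ℕ → ℝ≥0∞) (s : ℝ≥0∞) :
    pgfENN (fun k => ∑' n, c n * convAdd p (iterConv f n) k) s
      = pgfENN p s * pgfENN c (pgfENN f s) := by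
  calc pgfENN (fun k => ∑' n, c n * convAdd p (iterConv f n) k) s
      = ∑' k, ∑' n, c n * convAdd p (iterConv f n) k * s ^ k :=
        tsum_congr fun k => ENNReal.tsum_mul_right.symm
    _ = ∑' n, c n * pgfENN (convAdd p (iterConv f n)) s := by
        rw [ENNReal.tsum_comm]
        refine tsum_congr fun n => ?_
        rw [pgfENN, ← ENNReal.tsum_mul_left]
        exact tsum_congr fun k => by rw [mul_assoc]
    _ = pgfENN p s * pgfENN c (pgfENN f s) := by
        rw [pgfENN.eq_def c, ← ENNReal.tsum_mul_left]
        refine tsum_congr fun n => ?_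
        rw [pgfENN_convAdd, pgfENN_iterConv]
        ring

lemma pgfENN_shiftLaw (μ : ℕ → ℝ≥0∞) (s : ℝ≥0∞) :
    pgfENN (shiftLaw μ) s * s + μ 0 = pgfENN μ s + μ 0 * s := by
  have h1 : pgfENN (shiftLaw μ) s = μ 0 + μ 1 + ∑' k, μ (k + 2) * s ^ (k + 1) := by
    rw [pgfENN, tsum_eq_zero_add' ENNReal.summable]
    simp [shiftLaw]
  have h2 : pgfENN μ s = μ 0 + (μ 1 * s + ∑' k, μ (k + 2) * s ^ (k + 2)) := by
    rw [pgfENN, tsum_eq_zero_add' ENNReal.summable, tsum_eq_zero_add' ENNReal.summable]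
    simp
  have h3 : (∑' k, μ (k + 2) * s ^ (k + 1)) * s = ∑' k, μ (k + 2) * s ^ (k + 2) := by
    rw [← ENNReal.tsum_mul_right]
    exact tsum_congr fun k => by ring
  rw [h1, h2, ← h3]
  ring

lemma pgfENN_geomHalf (h : ℝ≥0∞) :
    2 * pgfENN geomHalf h = 1 + h * pgfENN geomHalf h := by
  have key : 2 * pgfENN geomHalf h = ∑' k, (h / 2) ^ k := by
    rw [pgfENN, ← ENNReal.tsum_mul_left]
    refine tsum_congr fun k => ?_
    rw [geomHalf, div_eq_mul_inv h, mul_pow, pow_succ, one_div]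
    calc 2 * ((2 : ℝ≥0∞)⁻¹ ^ k * 2⁻¹ * h ^ k) = (2 * 2⁻¹) * (h ^ k * 2⁻¹ ^ k) := by ring
      _ = _ := by rw [ENNReal.mul_inv_cancel (by simp) (by simp), one_mul]
  have h2 : h * pgfENN geomHalf h = (h / 2) * ∑' k, (h / 2) ^ k := by
    rw [← key, ← mul_assoc, ENNReal.div_mul_cancel (by simp) (by simp)]
  rw [h2, key, ← ENNReal.tsum_mul_left, tsum_eq_zero_add' ENNReal.summable]
  simp [pow_succ']

lemma pgfENN_geomHalf_one : pgfENN geomHalf 1 = 1 := by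
  rw [pgfENN_one]
  have := ENNReal.tsum_geometric_add_one (1 / 2 : ℝ≥0∞)
  simp only [geomHalf]
  rw [this, one_div, ENNReal.one_sub_inv_two, inv_inv, ENNReal.inv_mul_cancel] <;> simp

lemma pgfENN_poissonPMF {α s : ℝ} (hα : 0 ≤ α) (hs : 0 ≤ s) :
    pgfENN (poissonPMF α) (ENNReal.ofReal s) = ENNReal.ofReal (Real.exp (α * (s - 1))) := by
  have h := (NormedSpace.expSeries_div_hasSum_exp (α * s)).mul_left (Real.exp (-α))
  rw [← Real.exp_eq_exp_ℝ, ← Real.exp_add] at h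
  have e : -α + α * s = α * (s - 1) := by ring
  rw [e] at h
  rw [← h.tsum_eq, ENNReal.ofReal_tsum_of_nonneg (fun k => by positivity) h.summable, pgfENN]
  refine tsum_congr fun k => ?_
  rw [poissonPMF, ← ENNReal.ofReal_pow hs, ← ENNReal.ofReal_mul (by positivity), mul_pow]
  congr 1
  ring

lemma SatisfiesRDE.pgfENN_eq {α : ℝ} {μ : ℕ → ℝ≥0∞} (hμ : SatisfiesRDE α μ) (s : ℝ≥0∞) :
    pgfENN μ s = pgfENN (poissonPMF α) s * pgfENN geomHalf (pgfENN (shiftLaw μ) s) := by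
  rw [← pgfENN_randomSum, ← funext hμ.2]

lemma pgfENN_lawY (α : ℝ) (μ : ℕ → ℝ≥0∞) (s : ℝ≥0∞) :
    pgfENN (lawY α μ) s
      = pgfENN (poissonPMF α) s * pgfENN geomHalf (pgfENN (shiftLaw μ) s) ^ 2 := by
  rw [sq, ← pgfENN_convAdd, ← pgfENN_randomSum]
  rfl

lemma pgf_eq_toReal {f : ℕ → ℝ≥0∞} (hf : ∑' k, f k ≠ ∞) {s : ℝ} (hs : 0 ≤ s) :
    pgf f s = (pgfENN f (ENNReal.ofReal s)).toReal := by
  rw [pgf, pgfENN, ENNReal.tsum_toReal_eq]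
  · simp [ENNReal.toReal_ofReal hs]
  · exact fun k => ENNReal.mul_ne_top (ENNReal.ne_top_of_tsum_ne_top hf k) (by simp)

lemma continuousOn_pgf {f : ℕ → ℝ≥0∞} (hf : ∑' k, f k ≠ ∞) :
    ContinuousOn (pgf f) (Set.Icc 0 1) := by
  refine continuousOn_tsum (u := fun k => (f k).toReal) (fun k => by fun_prop)
    (ENNReal.summable_toReal hf) fun k s hs => ?_
  rw [norm_mul, norm_pow, Real.norm_of_nonneg hs.1, Real.norm_of_nonneg ENNReal.toReal_nonneg]
  exact mul_le_of_le_one_right ENNReal.toReal_nonneg (pow_le_one₀ hs.1 hs.2)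

lemma pgf_le_one {f : ℕ → ℝ≥0∞} (hf : ∑' k, f k = 1) {s : ℝ} (hs0 : 0 ≤ s) (hs1 : s ≤ 1) :
    pgf f s ≤ 1 := by
  rw [pgf_eq_toReal (by simp [hf]) hs0]
  refine ENNReal.toReal_le_of_le_ofReal zero_le_one ?_
  rw [ENNReal.ofReal_one, ← hf, ← pgfENN_one]
  exact pgfENN_mono f (ENNReal.ofReal_le_one.2 hs1)

lemma SatisfiesRDE.pgfENN_shiftLaw_one {α : ℝ} {μ : ℕ → ℝ≥0∞} (hμ : SatisfiesRDE α μ) :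
    pgfENN (shiftLaw μ) 1 = 1 := by
  have h := pgfENN_shiftLaw μ 1
  rw [mul_one, mul_one, pgfENN_one μ, hμ.1] at h
  exact (ENNReal.add_left_inj (ENNReal.ne_top_of_tsum_ne_top (by simp [hμ.1]) 0)).1 h

lemma SatisfiesRDE.tsum_lawY {α : ℝ} (hα : 0 ≤ α) {μ : ℕ → ℝ≥0∞} (hμ : SatisfiesRDE α μ) :
    ∑' k, lawY α μ k = 1 := by
  have hP := pgfENN_poissonPMF hα zero_le_one
  rw [← pgfENN_one, pgfENN_lawY, hμ.pgfENN_shiftLaw_one, pgfENN_geomHalf_one]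
  simpa using hP

/-- The functional equation of the generating function of a solution, with the
square completed, and its relation to the generating function of `lawY`. -/
lemma SatisfiesRDE.pgf_quadratic {α : ℝ} (hα : 0 ≤ α) {μ : ℕ → ℝ≥0∞} (hμ : SatisfiesRDE α μ)
    {s : ℝ} (hs0 : 0 ≤ s) (hs1 : s ≤ 1) :
    (2 * pgf μ s - (2 * s + (μ 0).toReal * (1 - s))) ^ 2
      = (2 * s + (μ 0).toReal * (1 - s)) ^ 2 - 4 * s * Real.exp (α * (s - 1)) ∧
    pgf (lawY α μ) s = pgf μ s ^ 2 * Real.exp (α * (1 - s)) := by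
  have hs1' : ENNReal.ofReal s ≤ 1 := ENNReal.ofReal_le_one.2 hs1
  have hH := (pgfENN_mono _ hs1').trans_eq hμ.pgfENN_shiftLaw_one
  have hg : pgfENN geomHalf (pgfENN (shiftLaw μ) (ENNReal.ofReal s)) ≤ 1 :=
    (pgfENN_mono _ hH).trans_eq pgfENN_geomHalf_one
  have hG : pgfENN μ (ENNReal.ofReal s) ≤ 1 := by
    rw [← hμ.1, ← pgfENN_one]; exact pgfENN_mono _ hs1'
  have e1 := congrArg ENNReal.toReal (hμ.pgfENN_eq (ENNReal.ofReal s))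
  have e2 := congrArg ENNReal.toReal
    (pgfENN_geomHalf (pgfENN (shiftLaw μ) (ENNReal.ofReal s)))
  have e3 := congrArg ENNReal.toReal (pgfENN_shiftLaw μ (ENNReal.ofReal s))
  have e4 := congrArg ENNReal.toReal (pgfENN_lawY α μ (ENNReal.ofReal s))
  have hp : μ 0 ≠ ∞ := ENNReal.ne_top_of_tsum_ne_top (by simp [hμ.1]) 0
  have hG' := ne_top_of_le_ne_top ENNReal.one_ne_top hG
  have hH' := ne_top_of_le_ne_top ENNReal.one_ne_top hH
  have hg' := ne_top_of_le_ne_top ENNReal.one_ne_top hg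
  rw [pgfENN_poissonPMF hα hs0] at e1 e4
  rw [ENNReal.toReal_add ENNReal.one_ne_top (ENNReal.mul_ne_top hH' hg')] at e2
  rw [ENNReal.toReal_add (ENNReal.mul_ne_top hH' ENNReal.ofReal_ne_top) hp,
    ENNReal.toReal_add hG' (ENNReal.mul_ne_top hp ENNReal.ofReal_ne_top)] at e3
  rw [← pgf_eq_toReal (by simp [hμ.tsum_lawY hα]) hs0] at e4
  rw [← pgf_eq_toReal (by simp [hμ.1]) hs0] at e1 e3
  simp only [ENNReal.toReal_mul, ENNReal.toReal_pow, ENNReal.toReal_ofReal hs0,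
    ENNReal.toReal_ofReal (Real.exp_pos _).le, ENNReal.toReal_one, ENNReal.toReal_ofNat]
    at e1 e2 e3 e4
  generalize (pgfENN geomHalf (pgfENN (shiftLaw μ) (ENNReal.ofReal s))).toReal = g at *
  generalize (pgfENN (shiftLaw μ) (ENNReal.ofReal s)).toReal = h at *
  have hE : Real.exp (α * (s - 1)) * Real.exp (α * (1 - s)) = 1 := by
    rw [← Real.exp_add]; ring_nf; simp
  refine ⟨?_, ?_⟩
  · linear_combination (-4 * s * (2 - h)) * e1 - 4 * s * Real.exp (α * (s - 1)) * e2
      - 4 * pgf μ s * e3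
  · rw [e4, e1]
    linear_combination (- g ^ 2 * Real.exp (α * (s - 1))) * hE

/-- The mean is the left derivative of the generating function at `1`. -/
lemma meanENN_eq_of_tendsto {f : ℕ → ℝ≥0∞} (hf : ∑' k, f k = 1) {m : ℝ}
    (hm : Filter.Tendsto (fun s => (1 - pgf f s) / (1 - s)) (nhdsWithin 1 (Set.Iio 1)) (nhds m)) :
    meanENN f = ENNReal.ofReal m := by
  set Q : ℝ → ℝ≥0∞ := fun s => ∑' k, (∑ i ∈ Finset.range k, ENNReal.ofReal s ^ i) * f k with hQ
  have hev : ∀ᶠ s : ℝ in nhdsWithin 1 (Set.Iio 1), s ∈ Set.Ioo (0 : ℝ) 1 :=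
    Ioo_mem_nhdsLT one_pos
  have hQeq : ∀ s ∈ Set.Ioo (0 : ℝ) 1, ENNReal.ofReal ((1 - pgf f s) / (1 - s)) = Q s := by
    intro s hs
    have hs1 : 0 < 1 - s := by linarith [hs.2]
    have hfin : pgfENN f (ENNReal.ofReal s) ≠ ∞ := by
      refine ne_top_of_le_ne_top ENNReal.one_ne_top ?_
      rw [← hf, ← pgfENN_one]
      exact pgfENN_mono f (ENNReal.ofReal_le_one.2 hs.2.le)
    have key : Q s * ENNReal.ofReal (1 - s) + pgfENN f (ENNReal.ofReal s) = 1 := by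
      rw [hQ, pgfENN, ← ENNReal.tsum_mul_right, ← ENNReal.tsum_add, ← hf]
      refine tsum_congr fun k => ?_
      have : (∑ i ∈ Finset.range k, ENNReal.ofReal s ^ i) * ENNReal.ofReal (1 - s)
          + ENNReal.ofReal s ^ k = 1 := by
        simp_rw [← ENNReal.ofReal_pow hs.1.le]
        have h0 : ∀ i ∈ Finset.range k, 0 ≤ s ^ i := fun i _ => pow_nonneg hs.1.le i
        rw [← ENNReal.ofReal_sum_of_nonneg h0,
          ← ENNReal.ofReal_mul (Finset.sum_nonneg h0),
          ← ENNReal.ofReal_add (mul_nonneg (Finset.sum_nonneg h0) hs1.le)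
            (pow_nonneg hs.1.le k), geom_sum_mul_neg]
        simp
      calc _ = f k * ((∑ i ∈ Finset.range k, ENNReal.ofReal s ^ i) * ENNReal.ofReal (1 - s)
          + ENNReal.ofReal s ^ k) := by ring
        _ = f k := by rw [this, mul_one]
    symm
    rw [ENNReal.ofReal_div_of_pos hs1, ENNReal.eq_div_iff (by simpa using hs1) (by simp),
      mul_comm, pgf_eq_toReal (by simp [hf]) hs.1.le, ENNReal.ofReal_sub _ ENNReal.toReal_nonneg,
      ENNReal.ofReal_toReal hfin, ENNReal.ofReal_one, ← key]
    exact (ENNReal.add_sub_cancel_right hfin).symm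
  have hQlim : Filter.Tendsto Q (nhdsWithin 1 (Set.Iio 1)) (nhds (ENNReal.ofReal m)) :=
    ((ENNReal.continuous_ofReal.tendsto m).comp hm).congr' <| by
      filter_upwards [hev] with s hs using hQeq s hs
  refine le_antisymm ?_ ?_
  · rw [meanENN, ENNReal.tsum_eq_iSup_sum]
    refine iSup_le fun S => ?_
    have hlim : Filter.Tendsto
        (fun s : ℝ => ∑ k ∈ S, (∑ i ∈ Finset.range k, ENNReal.ofReal s ^ i) * f k)
        (nhdsWithin 1 (Set.Iio 1)) (nhds (∑ k ∈ S, (k : ℝ≥0∞) * f k)) := by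
      refine tendsto_finsetSum _ fun k _ => ?_
      refine ENNReal.Tendsto.mul_const ?_
        (Or.inr (ENNReal.ne_top_of_tsum_ne_top (by simp [hf]) k))
      have : (k : ℝ≥0∞) = ∑ i ∈ Finset.range k, ENNReal.ofReal 1 ^ i := by simp
      rw [this]
      refine tendsto_finsetSum _ fun i _ => ?_
      exact (((ENNReal.continuous_pow i).comp ENNReal.continuous_ofReal).tendsto 1).mono_left
        nhdsWithin_le_nhds
    exact le_of_tendsto_of_tendsto' hlim hQlim fun s => ENNReal.sum_le_tsum S
  · refine le_of_tendsto hQlim ?_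
    filter_upwards [hev] with s hs
    refine ENNReal.tsum_le_tsum fun k => ?_
    gcongr
    calc ∑ i ∈ Finset.range k, ENNReal.ofReal s ^ i ≤ ∑ i ∈ Finset.range k, 1 :=
          Finset.sum_le_sum fun i _ => pow_le_one₀ zero_le (ENNReal.ofReal_le_one.2 hs.2.le)
      _ = k := by simp

lemma disc_pos {α p s : ℝ} (hα0 : 0 < α) (hα : α ^ 2 + 2 * α ≤ 1) (hp : 1 - α ≤ p)
    (hs0 : 0 ≤ s) (hs1 : s < 1) :
    0 < (2 * s + p * (1 - s)) ^ 2 - 4 * s * Real.exp (α * (s - 1)) := by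
  have hα1 : 0 < 1 - α := by nlinarith
  rcases hs0.eq_or_lt with rfl | hs0
  · have : 0 < p := by linarith
    simpa using pow_pos this 2
  have hpos : ∀ x : ℝ, 0 < x → 0 < 1 - α + (1 + α) * x := fun x hx => by positivity
  have hd : ∀ x : ℝ, 0 < x →
      HasDerivAt (fun x => 2 * Real.log (1 - α + (1 + α) * x) - Real.log x - α * x)
        (2 * ((1 + α) / (1 - α + (1 + α) * x)) - 1 / x - α) x := by
    intro x hx
    have h1 : HasDerivAt (fun x => 1 - α + (1 + α) * x) (1 + α) x := by
      simpa using ((hasDerivAt_id x).const_mul (1 + α)).const_add (1 - α)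
    have h2 : HasDerivAt (fun x => α * x) α x := by
      simpa using (hasDerivAt_id x).const_mul α
    exact (((h1.log (hpos x hx).ne').const_mul 2).sub ((hasDerivAt_id x).log hx.ne')).sub h2
  have hanti : StrictAntiOn
      (fun x => 2 * Real.log (1 - α + (1 + α) * x) - Real.log x - α * x) (Set.Ioc 0 1) := by
    refine strictAntiOn_of_deriv_neg (convex_Ioc 0 1)
      (fun x hx => (hd x hx.1).continuousAt.continuousWithinAt) fun x hx => ?_
    rw [interior_Ioc] at hx
    rw [(hd x hx.1).deriv]
    have hx0 := hx.1
    have hp' := hpos x hx.1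
    have hfac : 0 < (1 - x) * (1 - α - α * (1 + α) * x) := by
      refine mul_pos (by linarith [hx.2]) ?_
      have : α * (1 + α) * x < α * (1 + α) := mul_lt_of_lt_one_right (by positivity) hx.2
      nlinarith
    have : 2 * ((1 + α) / (1 - α + (1 + α) * x)) - 1 / x - α
        = - ((1 - x) * (1 - α - α * (1 + α) * x)) / (x * (1 - α + (1 + α) * x)) := by
      field_simp
      ring
    rw [this]
    exact div_neg_of_neg_of_pos (by linarith) (by positivity)
  have hlt := hanti ⟨hs0, hs1.le⟩ ⟨one_pos, le_rfl⟩ hs1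
  have hA := hpos s hs0
  have hlog : Real.log (4 * s * Real.exp (α * (s - 1)))
      < Real.log ((1 - α + (1 + α) * s) ^ 2) := by
    have h4 : Real.log 4 = 2 * Real.log 2 := by
      rw [show (4 : ℝ) = 2 ^ 2 by norm_num, Real.log_pow]; norm_num
    rw [Real.log_mul (by positivity) (by positivity), Real.log_mul (by positivity) hs0.ne',
      Real.log_exp, Real.log_pow, h4]
    have e : 1 - α + (1 + α) * 1 = 2 := by ring
    simp only [e, Real.log_one] at hlt
    push_cast
    linarith
  have h1 := (Real.log_lt_log_iff (by positivity) (by positivity)).1 hlog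
  have h2 : (1 - α + (1 + α) * s) ^ 2 ≤ (2 * s + p * (1 - s)) ^ 2 := by
    refine pow_le_pow_left₀ hA.le ?_ 2
    nlinarith
  linarith

lemma nonneg_of_forall_mul_add_nonneg {a c : ℝ}
    (h : ∀ t : ℝ, 0 < t → t ≤ 1 → 0 ≤ a + c * t) : 0 ≤ a := by
  have h1 : Filter.Tendsto (fun t : ℝ => a + c * t) (nhdsWithin 0 (Set.Ioi 0)) (nhds a) := by
    have : Continuous fun t : ℝ => a + c * t := by fun_prop
    simpa using (this.tendsto 0).mono_left (nhdsWithin_le_nhds (s := Set.Ioi 0))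
  refine ge_of_tendsto h1 ?_
  filter_upwards [Ioo_mem_nhdsGT (zero_lt_one' ℝ)] with t ht using h t ht.1 ht.2.le

/-- The generating function of a solution follows the upper branch of the quadratic. -/
lemma SatisfiesRDE.pgf_upper_branch {α : ℝ} (hα0 : 0 < α) (hα : α ^ 2 + 2 * α ≤ 1)
    {μ : ℕ → ℝ≥0∞} (hμ : SatisfiesRDE α μ) (hp : 1 - α ≤ (μ 0).toReal) {s : ℝ}
    (hs : s ∈ Set.Ico (0 : ℝ) 1) :
    0 < 2 * pgf μ s - (2 * s + (μ 0).toReal * (1 - s)) := by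
  by_contra! hneg
  have hcont : ContinuousOn (fun s => 2 * pgf μ s - (2 * s + (μ 0).toReal * (1 - s)))
      (Set.Ico 0 1) := by
    have := (continuousOn_pgf (f := μ) (by simp [hμ.1])).mono Set.Ico_subset_Icc_self
    fun_prop
  have h0 : pgf μ 0 = (μ 0).toReal := by
    rw [pgf_eq_toReal (by simp [hμ.1]) le_rfl, ENNReal.ofReal_zero, pgfENN_zero]
  have hp0 : 0 < (μ 0).toReal := by nlinarith
  obtain ⟨x, hx, hx0⟩ := isPreconnected_Ico.intermediate_value hs
    (⟨le_rfl, one_pos⟩ : (0 : ℝ) ∈ Set.Ico (0 : ℝ) 1) hcont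
    (⟨hneg, by simp only [h0]; linarith⟩ : (0 : ℝ) ∈ Set.Icc _ _)
  have hq := (hμ.pgf_quadratic hα0.le hx.1 hx.2.le).1
  have hd := disc_pos hα0 hα hp hx.1 hx.2
  simp only at hx0
  rw [← hq, hx0] at hd
  simp at hd

lemma SatisfiesRDE.toReal_zero {α : ℝ} (hα0 : 0 < α) (hα : α ^ 2 + 2 * α ≤ 1)
    {μ : ℕ → ℝ≥0∞} (hμ : SatisfiesRDE α μ) : (μ 0).toReal = 1 - α := by
  set p := (μ 0).toReal with hp
  have hge : 0 ≤ 4 * (p - 1 + α) := by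
    refine nonneg_of_forall_mul_add_nonneg (c := (2 - p) ^ 2 - 4 * α) fun t ht0 ht1 => ?_
    have hq := (hμ.pgf_quadratic hα0.le (sub_nonneg.2 ht1) (by linarith)).1
    have hsq := sq_nonneg (2 * pgf μ (1 - t) - (2 * (1 - t) + p * (1 - (1 - t))))
    have hexp := Real.add_one_le_exp (α * (1 - t - 1))
    have h1 := mul_le_mul_of_nonneg_left hexp (sub_nonneg.2 ht1)
    refine nonneg_of_mul_nonneg_right (a := t) ?_ ht0
    rw [← hp] at hq
    nlinarith
  refine le_antisymm ?_ (by linarith)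
  suffices h : 0 ≤ 1 - α - p by linarith
  refine nonneg_of_forall_mul_add_nonneg (c := α * (2 - p)) fun t ht0 ht1 => ?_
  have hs : 1 - t ∈ Set.Ico (0 : ℝ) 1 := ⟨by linarith, by linarith⟩
  have hq := (hμ.pgf_quadratic hα0.le hs.1 hs.2.le).1
  have hb := hμ.pgf_upper_branch hα0 hα (by linarith) hs
  have hle := pgf_le_one hμ.1 hs.1 hs.2.le
  rw [← hp] at hq hb
  have hsq := pow_le_pow_left₀ hb.le
    (show 2 * pgf μ (1 - t) - (2 * (1 - t) + p * (1 - (1 - t))) ≤ (2 - p) * t by linarith) 2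
  rw [hq] at hsq
  have hexp := Real.add_one_le_exp (α * t)
  have hE : Real.exp (α * t) * Real.exp (α * (1 - t - 1)) = 1 := by
    rw [← Real.exp_add]; ring_nf; simp
  have hmul : (α * t + 1) * Real.exp (α * (1 - t - 1)) ≤ 1 := by
    exact (mul_le_mul_of_nonneg_right hexp (Real.exp_pos _).le).trans_eq hE
  have h1 : 1 - (2 - p) * t ≤ (1 - t) * Real.exp (α * (1 - t - 1)) := by nlinarith
  have h2 : (α * t + 1) * (1 - (2 - p) * t) ≤ 1 - t :=
    calc (α * t + 1) * (1 - (2 - p) * t)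
        ≤ (α * t + 1) * ((1 - t) * Real.exp (α * (1 - t - 1))) := by gcongr
      _ = (1 - t) * ((α * t + 1) * Real.exp (α * (1 - t - 1))) := by ring
      _ ≤ (1 - t) * 1 := by have := hs.1; gcongr
      _ = 1 - t := mul_one _
  refine nonneg_of_mul_nonneg_right (a := t) ?_ ht0
  nlinarith

lemma tendsto_exp_sub_sub_div_sq (α : ℝ) :
    Filter.Tendsto (fun t => (Real.exp (-α * t) - 1 + α * t) / t ^ 2)
      (nhdsWithin 0 (Set.Ioi 0)) (nhds (α ^ 2 / 2)) := by
  rw [tendsto_iff_norm_sub_tendsto_zero]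
  have hlim : Filter.Tendsto (fun t : ℝ => |α| ^ 3 * t) (nhdsWithin 0 (Set.Ioi 0)) (nhds 0) := by
    have : Continuous fun t : ℝ => |α| ^ 3 * t := by fun_prop
    simpa using (this.tendsto 0).mono_left (nhdsWithin_le_nhds (s := Set.Ioi 0))
  have hsmall : ∀ᶠ t : ℝ in nhdsWithin 0 (Set.Ioi 0), |-α * t| < 1 := by
    have : Continuous fun t : ℝ => |-α * t| := by fun_prop
    exact ((this.tendsto 0).mono_left nhdsWithin_le_nhds).eventually_lt_const (by simp)
  refine squeeze_zero' (Filter.Eventually.of_forall fun t => norm_nonneg _) ?_ hlim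
  filter_upwards [hsmall, self_mem_nhdsWithin] with t ht ht0
  have ht0 : 0 < t := ht0
  have h := Real.exp_bound ht.le (n := 3) (by norm_num)
  have e : (Real.exp (-α * t) - 1 + α * t) / t ^ 2 - α ^ 2 / 2
      = (Real.exp (-α * t) - (1 - α * t + (α * t) ^ 2 / 2)) / t ^ 2 := by
    field_simp
    ring
  rw [e, norm_div, Real.norm_eq_abs, Real.norm_of_nonneg (sq_nonneg t), div_le_iff₀ (by positivity)]
  have e2 : ∑ m ∈ Finset.range 3, (-α * t) ^ m / (Nat.factorial m : ℝ)
      = 1 - α * t + (α * t) ^ 2 / 2 := by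
    simp [Finset.sum_range_succ, Nat.factorial]
    ring
  rw [e2] at h
  refine h.trans ?_
  rw [abs_mul, abs_neg, abs_of_pos ht0]
  have : (0 : ℝ) ≤ |α| ^ 3 * t ^ 3 := by positivity
  norm_num [Nat.factorial]
  nlinarith

lemma tendsto_one_sub_nhdsLT_one :
    Filter.Tendsto (fun s : ℝ => 1 - s) (nhdsWithin 1 (Set.Iio 1)) (nhdsWithin 0 (Set.Ioi 0)) := by
  refine tendsto_nhdsWithin_iff.2 ⟨?_, ?_⟩
  · have : Continuous fun s : ℝ => 1 - s := by fun_prop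
    simpa using (this.tendsto 1).mono_left (nhdsWithin_le_nhds (s := Set.Iio 1))
  · filter_upwards [self_mem_nhdsWithin] with s hs
    simpa using hs

lemma tendsto_exp_sub_one_div (α : ℝ) :
    Filter.Tendsto (fun t => (Real.exp (α * t) - 1) / t) (nhdsWithin 0 (Set.Ioi 0)) (nhds α) := by
  have h : HasDerivAt (fun t => Real.exp (α * t)) α 0 := by
    simpa using ((hasDerivAt_id (0 : ℝ)).const_mul α).exp
  have := (hasDerivAt_iff_tendsto_slope.1 h).mono_left
    (nhdsWithin_mono _ fun x (hx : (0 : ℝ) < x) => hx.ne')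
  refine this.congr fun t => ?_
  simp [slope_def_field]

lemma SatisfiesRDE.tendsto_pgf {α : ℝ} (hα0 : 0 < α) (hα : α ^ 2 + 2 * α ≤ 1)
    {μ : ℕ → ℝ≥0∞} (hμ : SatisfiesRDE α μ) :
    Filter.Tendsto (fun s => (1 - pgf μ s) / (1 - s)) (nhdsWithin 1 (Set.Iio 1))
      (nhds ((1 + α - Real.sqrt (1 - 2 * α - α ^ 2)) / 2)) := by
  have hp := hμ.toReal_zero hα0 hα
  have hφ := (tendsto_exp_sub_sub_div_sq α).comp tendsto_one_sub_nhdsLT_one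
  have hs : Filter.Tendsto (fun s : ℝ => s) (nhdsWithin 1 (Set.Iio 1)) (nhds 1) :=
    nhdsWithin_le_nhds
  have hlim := ((((hs.const_mul 4).mul hφ).const_sub ((1 - α) ^ 2)).sqrt.const_sub
    (1 + α)).div_const 2
  have e : (1 - α) ^ 2 - 4 * 1 * (α ^ 2 / 2) = 1 - 2 * α - α ^ 2 := by ring
  rw [e] at hlim
  refine hlim.congr' ?_
  filter_upwards [Ioo_mem_nhdsLT (zero_lt_one' ℝ)] with s hs
  have ht : 0 < 1 - s := by linarith [hs.2]
  have hq := (hμ.pgf_quadratic hα0.le hs.1.le hs.2.le).1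
  have hb := hμ.pgf_upper_branch hα0 hα hp.ge ⟨hs.1.le, hs.2⟩
  rw [hp] at hq hb
  have hsqrt : Real.sqrt ((1 - α) ^ 2 - 4 * s * ((Real.exp (-α * (1 - s)) - 1 + α * (1 - s))
      / (1 - s) ^ 2)) = (2 * pgf μ s - (2 * s + (1 - α) * (1 - s))) / (1 - s) := by
    rw [Real.sqrt_eq_iff_mul_self_eq_of_pos (div_pos hb ht), ← sq, div_pow, hq]
    have : α * (s - 1) = -α * (1 - s) := by ring
    rw [this]
    field_simp
    ring
  simp only [Function.comp_apply]
  rw [hsqrt]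
  field_simp
  ring

lemma SatisfiesRDE.tendsto_pgf_lawY {α : ℝ} (hα0 : 0 < α) (hα : α ^ 2 + 2 * α ≤ 1)
    {μ : ℕ → ℝ≥0∞} (hμ : SatisfiesRDE α μ) :
    Filter.Tendsto (fun s => (1 - pgf (lawY α μ) s) / (1 - s)) (nhdsWithin 1 (Set.Iio 1))
      (nhds (1 - Real.sqrt (1 - 2 * α - α ^ 2))) := by
  have hw := hμ.tendsto_pgf hα0 hα
  have hd := (tendsto_exp_sub_one_div α).comp tendsto_one_sub_nhdsLT_one
  have ht : Filter.Tendsto (fun s : ℝ => 1 - s) (nhdsWithin 1 (Set.Iio 1)) (nhds 0) :=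
    tendsto_one_sub_nhdsLT_one.mono_right nhdsWithin_le_nhds
  have hE : Filter.Tendsto (fun s : ℝ => Real.exp (α * (1 - s))) (nhdsWithin 1 (Set.Iio 1))
      (nhds 1) := by
    simpa using (ht.const_mul α).rexp
  have hlim := ((hw.mul ((ht.mul hw).const_sub 2)).mul hE).sub hd
  have e : ∀ w : ℝ, (1 + α - w) / 2 * (2 - 0 * ((1 + α - w) / 2)) * 1 - α = 1 - w :=
    fun w => by ring
  rw [e] at hlim
  refine hlim.congr' ?_
  filter_upwards [Ioo_mem_nhdsLT (zero_lt_one' ℝ)] with s hs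
  have ht : 0 < 1 - s := by linarith [hs.2]
  rw [(hμ.pgf_quadratic hα0.le hs.1.le hs.2.le).2]
  simp only [Function.comp_apply]
  field_simp
  ring

/-- For 0 < α ≤ √2 − 1 and X satisfying the RDE, the random variable
Y = P + ∑_{i=1}^{N₁+N₂} (X_i − 1)⁺ has E[Y] = 1 − √(1 − 2α − α²) and
P(Y = 0) = (1−α)²·exp(α). -/
theorem lawY_mean_and_prob_zero
    (α : ℝ) (hα0 : 0 < α) (hα1 : α ≤ Real.sqrt 2 - 1)
    (μ : ℕ → ℝ≥0∞) (hμ : SatisfiesRDE α μ) :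
    meanENN (lawY α μ) = ENNReal.ofReal (1 - Real.sqrt (1 - 2 * α - α ^ 2)) ∧
    lawY α μ 0 = ENNReal.ofReal ((1 - α) ^ 2 * Real.exp α) := by
  have hα : α ^ 2 + 2 * α ≤ 1 := by
    have h2 : Real.sqrt 2 ^ 2 = 2 := Real.sq_sqrt (by norm_num)
    nlinarith [Real.sqrt_nonneg 2]
  have hY := hμ.tsum_lawY hα0.le
  refine ⟨meanENN_eq_of_tendsto hY (hμ.tendsto_pgf_lawY hα0 hα), ?_⟩
  have h := (hμ.pgf_quadratic hα0.le le_rfl zero_le_one).2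
  rw [pgf_eq_toReal (by simp [hY]) le_rfl, pgf_eq_toReal (by simp [hμ.1]) le_rfl,
    ENNReal.ofReal_zero, pgfENN_zero, pgfENN_zero, hμ.toReal_zero hα0 hα, sub_zero, mul_one] at h
  rw [← h, ENNReal.ofReal_toReal (ENNReal.ne_top_of_tsum_ne_top (by simp [hY]) 0)]
end
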